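/- For every n ≥ 1 and every θ ∈ Ω^{n−1} one has iⁿ(dθ) = −n·L(i^{n−1}θ). In particular, iⁿ(dθ) lies in the image of L (exact n-forms give L-coboundaries), so together with the closedness identity this yields a well-defined map from n-th de Rham-type cohomology ker d/im d to the L-cohomology of Ω⁰. -/

import Mathlib

noncomputable section

/-- The iterated contraction `iⁿ : Ωⁿ → Ω⁰`. -/
def iterContr (Ω : ℤ → Type*) [∀ k, AddCommGroup (Ω k)] [∀ k, Module ℝ (Ω k)]
    (i : ∀ k : ℤ, Ω (k + 1) →ₗ[ℝ] Ω k) : ∀ n : ℕ, Ω (n : ℤ) →ₗ[ℝ] Ω (0 : ℤ)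
  | 0 => LinearMap.id
  | n + 1 => (iterContr Ω i n) ∘ₗ (i (n : ℤ))

/-- The iterated contraction intertwines `L` on `Ωⁿ` with `L` on `Ω⁰`. -/
theorem iterContr_comm
    (Ω : ℤ → Type*) [∀ k, AddCommGroup (Ω k)] [∀ k, Module ℝ (Ω k)]
    (i : ∀ k : ℤ, Ω (k + 1) →ₗ[ℝ] Ω k) (L : ∀ k : ℤ, Ω k →ₗ[ℝ] Ω k)
    (hLi : ∀ (k : ℤ) (x : Ω (k + 1)), L k (i k x) = i k (L (k + 1) x)) :
    ∀ (m : ℕ) (x : Ω (m : ℤ)), iterContr Ω i m (L (m : ℤ) x) = L 0 (iterContr Ω i m x)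
  | 0, _ => rfl
  | m + 1, x =>
    (congrArg (iterContr Ω i m) (hLi (m : ℤ) x).symm).trans
      (iterContr_comm Ω i L hLi m (i (m : ℤ) x))

/-- The homotopy identity `iⁿ(dθ) = −n·L(i^{n−1}θ)`, with `n = m + 1`. -/
theorem iterContr_succ_d
    (Ω : ℤ → Type*) [∀ k, AddCommGroup (Ω k)] [∀ k, Module ℝ (Ω k)]
    (hzero : ∀ k : ℤ, k < 0 → ∀ x : Ω k, x = 0)
    (d : ∀ k : ℤ, Ω k →ₗ[ℝ] Ω (k + 1)) (i : ∀ k : ℤ, Ω (k + 1) →ₗ[ℝ] Ω k)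
    (L : ∀ k : ℤ, Ω k →ₗ[ℝ] Ω k)
    (hL : ∀ (k : ℤ) (x : Ω (k + 1)), L (k + 1) x = d k (i k x) - i (k + 1) (d (k + 1) x))
    (hLi : ∀ (k : ℤ) (x : Ω (k + 1)), L k (i k x) = i k (L (k + 1) x))
    (m : ℕ) (θ : Ω (m : ℤ)) :
    iterContr Ω i (m + 1) (d (m : ℤ) θ) = -(((m : ℝ) + 1) • L 0 (iterContr Ω i m θ)) := by
  induction m with
  | zero =>
    have key : ∀ n : ℤ, -1 + 1 = n → ∀ x : Ω n, L n x = -i n (d n x) := by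
      rintro _ rfl x
      rw [hL (-1) x, hzero (-1) (by norm_num) (i (-1) x), map_zero, zero_sub]
    have h : L 0 θ = -i 0 (d 0 θ) := key 0 (by norm_num) θ
    change i 0 (d 0 θ) = -((((0 : ℕ) : ℝ) + 1) • L 0 θ)
    rw [h]
    simp
  | succ m ih =>
    have hid : i ((m : ℤ) + 1) (d ((m : ℤ) + 1) θ)
        = d (m : ℤ) (i (m : ℤ) θ) - L ((m : ℤ) + 1) θ := by
      rw [hL (m : ℤ) θ, sub_sub_cancel]
    have hcomm : iterContr Ω i (m + 1) (L ((m : ℤ) + 1) θ) = L 0 (iterContr Ω i (m + 1) θ) :=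
      iterContr_comm Ω i L hLi (m + 1) θ
    have hih : iterContr Ω i (m + 1) (d (m : ℤ) (i (m : ℤ) θ))
        = -(((m : ℝ) + 1) • L 0 (iterContr Ω i (m + 1) θ)) := ih (i (m : ℤ) θ)
    calc iterContr Ω i (m + 1 + 1) (d ((m : ℤ) + 1) θ)
        = iterContr Ω i (m + 1) (d (m : ℤ) (i (m : ℤ) θ) - L ((m : ℤ) + 1) θ) :=
          congrArg (iterContr Ω i (m + 1)) hid
      _ = iterContr Ω i (m + 1) (d (m : ℤ) (i (m : ℤ) θ))
            - iterContr Ω i (m + 1) (L ((m : ℤ) + 1) θ) :=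
          map_sub (iterContr Ω i (m + 1)) _ _
      _ = -((((m + 1 : ℕ) : ℝ) + 1) • L 0 (iterContr Ω i (m + 1) θ)) := by
          rw [hcomm, hih]
          push_cast
          module

/-- **Statement 11.** Let `(Ωᵏ)_{k∈ℤ}` be real vector spaces with `Ωᵏ = 0` for `k < 0`,
with maps `d : Ωᵏ → Ω^{k+1}`, `i : Ωᵏ → Ω^{k−1}`, and `L = d∘i − i∘d`, assuming
`L∘i = i∘L`. Then for every `n ≥ 1` (written `n = m+1`) and `θ ∈ Ω^{n−1}` one has
`iⁿ(dθ) = −n·L(i^{n−1}θ)`; in particular `iⁿ(dθ)` lies in the image of `L` on `Ω⁰`. -/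
theorem exact_forms_give_L_coboundaries
    (Ω : ℤ → Type*) [∀ k, AddCommGroup (Ω k)] [∀ k, Module ℝ (Ω k)]
    (hzero : ∀ k : ℤ, k < 0 → ∀ x : Ω k, x = 0)
    (d : ∀ k : ℤ, Ω k →ₗ[ℝ] Ω (k + 1)) (i : ∀ k : ℤ, Ω (k + 1) →ₗ[ℝ] Ω k)
    (L : ∀ k : ℤ, Ω k →ₗ[ℝ] Ω k)
    (hL : ∀ (k : ℤ) (x : Ω (k + 1)), L (k + 1) x = d k (i k x) - i (k + 1) (d (k + 1) x))
    (hLi : ∀ (k : ℤ) (x : Ω (k + 1)), L k (i k x) = i k (L (k + 1) x)) :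
    ∀ (m : ℕ) (θ : Ω (m : ℤ)),
      iterContr Ω i (m + 1) (d (m : ℤ) θ) = -(((m : ℝ) + 1) • L 0 (iterContr Ω i m θ)) ∧
      iterContr Ω i (m + 1) (d (m : ℤ) θ) ∈ LinearMap.range (L 0) := by
  intro m θ
  have h := iterContr_succ_d Ω hzero d i L hL hLi m θ
  refine ⟨h, -(((m : ℝ) + 1) • iterContr Ω i m θ), ?_⟩
  rw [h, map_neg, map_smul]
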